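/- Let P_{XY} be a Borel probability measure on ℝ^p × ℝ^q with marginals P_X on ℝ^p and P_Y on ℝ^q, and let (X1,Y1), …, (X6,Y6) be i.i.d. with law P_{XY}; assume P(X1 = X2) = 0 and P(Y1 = Y2) = 0. For α ∈ S^{p−1}, β ∈ S^{q−1} let F_{α,β}(u,v) = P(⟨α,X⟩ ≤ u and ⟨β,Y⟩ ≤ v), F_α(u) = P_X({x : ⟨α,x⟩ ≤ u}), G_β(v) = P_Y({y : ⟨β,y⟩ ≤ v}), and let μ_α, ν_β be the laws of ⟨α,X⟩ and ⟨β,Y⟩ respectively. Then ∫_{S^{p−1}} ∫_{S^{q−1}} ∫∫ [ F_{α,β}(u,v) − F_α(u)·G_β(v) ]² dμ_α(u) dν_β(v) dλ_q(β) dλ_p(α) = E[ (1/2 − (1/(2π))·Ang(X1−X3, X2−X3)) · (1/2 − (1/(2π))·Ang(Y1−Y4, Y2−Y4)) ] + E[ (1/2 − (1/(2π))·Ang(X1−X5, X2−X5)) · (1/2 − (1/(2π))·Ang(Y3−Y6, Y4−Y6)) ] − 2·E[ (1/2 − (1/(2π))·Ang(X1−X4, X2−X4)) · (1/2 − (1/(2π))·Ang(Y1−Y5,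 Y3−Y5)) ]. -/

import Mathlib

open MeasureTheory ProbabilityTheory Real
open scoped RealInnerProductSpace ENNReal BigOperators

noncomputable section

/-- The standard Gaussian measure on `ℝ^d = EuclideanSpace ℝ (Fin d)`. -/
def stdGaussian (d : ℕ) : Measure (EuclideanSpace ℝ (Fin d)) :=
  (Measure.pi fun _ : Fin d => gaussianReal 0 1).map
    ⇑(EuclideanSpace.equiv (Fin d) ℝ).symm

/-- The uniform (rotation-invariant) probability measure `λ` on the unit sphere
`S^{d-1} = {x : ‖x‖ = 1} ⊆ ℝ^d`, realized as a Borel measure on `ℝ^d` concentrated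
on the sphere: the pushforward of the standard Gaussian under `x ↦ ‖x‖⁻¹ • x`. -/
def sphereUniform (d : ℕ) : Measure (EuclideanSpace ℝ (Fin d)) :=
  (stdGaussian d).map fun x => ‖x‖⁻¹ • x

/-- `Ang u v = arccos (⟪u,v⟫ / (‖u‖ ‖v‖)) ∈ [0, π]`, the angle between two nonzero vectors. -/
def Ang {d : ℕ} (u v : EuclideanSpace ℝ (Fin d)) : ℝ :=
  Real.arccos (⟪u, v⟫ / (‖u‖ * ‖v‖))

theorem meas_le_and {X : Type*} [MeasurableSpace X] {f g h k : X → ℝ} (hf : Measurable f)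
    (hg : Measurable g) (hh : Measurable h) (hk : Measurable k) :
    MeasurableSet {x | f x ≤ g x ∧ h x ≤ k x} :=
  (measurableSet_le hf hg).inter (measurableSet_le hh hk)

/-- Gaussian pairs of linear functionals with equal Gram matrices have the same joint law. -/
theorem gaussian_pair_law {E F : Type*}
    [NormedAddCommGroup E] [InnerProductSpace ℝ E] [FiniteDimensional ℝ E] [MeasurableSpace E]
    [BorelSpace E]
    [NormedAddCommGroup F] [InnerProductSpace ℝ F] [FiniteDimensional ℝ F] [MeasurableSpace F]
    [BorelSpace F] (u v : E) (u' v' : F) (h1 : ‖u‖ = ‖u'‖) (h2 : ‖v‖ = ‖v'‖)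
    (h3 : ⟪u, v⟫ = ⟪u', v'⟫) :
    (ProbabilityTheory.stdGaussian E).map (fun x => (⟪u, x⟫, ⟪v, x⟫)) =
      (ProbabilityTheory.stdGaussian F).map (fun x => (⟪u', x⟫, ⟪v', x⟫)) := by
  have e1 : (fun x : E => (⟪u, x⟫, ⟪v, x⟫)) = ⇑((innerSL ℝ u).prod (innerSL ℝ v)) := by
    ext x <;> simp
  have e2 : (fun x : F => (⟪u', x⟫, ⟪v', x⟫)) = ⇑((innerSL ℝ u').prod (innerSL ℝ v')) := by
    ext x <;> simp
  rw [e1, e2]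
  have : IsFiniteMeasure
      ((ProbabilityTheory.stdGaussian E).map ⇑((innerSL ℝ u).prod (innerSL ℝ v))) := by
    infer_instance
  apply Measure.ext_of_charFunDual
  ext D
  rw [charFunDual_map, charFunDual_map, charFunDual_stdGaussian, charFunDual_stdGaussian]
  have k1 : D.comp ((innerSL ℝ u).prod (innerSL ℝ v)) =
      innerSL ℝ (D (1, 0) • u + D (0, 1) • v) := by
    ext x
    have : ((⟪u, x⟫, ⟪v, x⟫) : ℝ × ℝ) = ⟪u, x⟫ • (1, 0) + ⟪v, x⟫ • (0, 1) := by simp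
    simp only [ContinuousLinearMap.comp_apply, ContinuousLinearMap.prod_apply, innerSL_apply_apply]
    rw [this, map_add, map_smul, map_smul, inner_add_left, real_inner_smul_left,
      real_inner_smul_left]
    simp only [smul_eq_mul]; ring
  have k2 : D.comp ((innerSL ℝ u').prod (innerSL ℝ v')) =
      innerSL ℝ (D (1, 0) • u' + D (0, 1) • v') := by
    ext x
    have : ((⟪u', x⟫, ⟪v', x⟫) : ℝ × ℝ) = ⟪u', x⟫ • (1, 0) + ⟪v', x⟫ • (0, 1) := by simp
    simp only [ContinuousLinearMap.comp_apply, ContinuousLinearMap.prod_apply, innerSL_apply_apply]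
    rw [this, map_add, map_smul, map_smul, inner_add_left, real_inner_smul_left,
      real_inner_smul_left]
    simp only [smul_eq_mul]; ring
  rw [k1, k2, innerSL_apply_norm, innerSL_apply_norm]
  have : ‖D (1, 0) • u + D (0, 1) • v‖ ^ 2 = ‖D (1, 0) • u' + D (0, 1) • v'‖ ^ 2 := by
    rw [norm_add_sq_real, norm_add_sq_real]
    simp only [norm_smul, real_inner_smul_left, real_inner_smul_right, h1, h2, h3]
  have h : (‖D (1, 0) • u + D (0, 1) • v‖ : ℂ) ^ 2 = (‖D (1, 0) • u' + D (0, 1) • v'‖ : ℂ) ^ 2 := by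
    exact_mod_cast this
  rw [h]

/-- Polar decomposition of the planar Gaussian measure of a cone. -/
theorem gaussian_cone (T : Set (ℝ × ℝ)) (S : Set ℝ) (hT : MeasurableSet T) (hS : MeasurableSet S)
    (h : ∀ r φ : ℝ, 0 < r → ((r * cos φ, r * sin φ) ∈ T ↔ φ ∈ S)) :
    ((gaussianReal 0 1).prod (gaussianReal 0 1)) T =
      (∫⁻ r in Set.Ioi (0:ℝ), ENNReal.ofReal r * ENNReal.ofReal ((2 * π)⁻¹ * rexp (- r ^ 2 / 2)))
        * volume (S ∩ Set.Ioo (-π) π) := by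
  have e : gaussianReal 0 1 = volume.withDensity (gaussianPDF 0 1) :=
    gaussianReal_of_var_ne_zero _ (by simp)
  rw [e, prod_withDensity (by fun_prop) (by fun_prop), withDensity_apply _ hT,
    ← lintegral_indicator hT]
  have : (volume : Measure ℝ).prod volume = (volume : Measure (ℝ × ℝ)) := rfl
  rw [this, ← lintegral_comp_polarCoord_symm]
  have hm : MeasurableSet polarCoord.target := polarCoord.open_target.measurableSet
  have key : ∀ x ∈ polarCoord.target, ENNReal.ofReal x.1 •
      T.indicator (fun z => gaussianPDF 0 1 z.1 * gaussianPDF 0 1 z.2) (polarCoord.symm x) =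
      (ENNReal.ofReal x.1 * ENNReal.ofReal ((2 * π)⁻¹ * rexp (- x.1 ^ 2 / 2))) *
        S.indicator (fun _ => 1) x.2 := by
    rintro ⟨r, φ⟩ ⟨hr, hφ⟩
    have hr : 0 < r := hr
    have hp : polarCoord.symm (r, φ) = (r * cos φ, r * sin φ) := rfl
    rw [hp]
    by_cases hs : φ ∈ S
    · rw [Set.indicator_of_mem ((h r φ hr).2 hs), Set.indicator_of_mem hs]
      simp only [gaussianPDF, smul_eq_mul, mul_one]
      congr 1
      rw [← ENNReal.ofReal_mul (gaussianPDFReal_nonneg _ _ _)]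
      congr 1
      simp only [gaussianPDFReal, NNReal.coe_one, mul_one, sub_zero]
      rw [mul_mul_mul_comm, ← Real.exp_add, ← mul_inv, Real.mul_self_sqrt (by positivity)]
      congr 2
      have := Real.sin_sq_add_cos_sq φ
      linear_combination (-r^2/2) * this
    · rw [Set.indicator_of_notMem (fun hh => hs ((h r φ hr).1 hh)), Set.indicator_of_notMem hs]
      simp
  rw [setLIntegral_congr_fun hm key]
  have ht : polarCoord.target = Set.Ioi (0 : ℝ) ×ˢ Set.Ioo (-π) π := rfl
  rw [ht, ← this, ← Measure.prod_restrict, lintegral_prod_mul (f := fun r =>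
    ENNReal.ofReal r * ENNReal.ofReal ((2 * π)⁻¹ * rexp (- r ^ 2 / 2)))
    (g := S.indicator (fun _ => 1)) (by fun_prop)
    ((measurable_const.indicator hS).aemeasurable)]
  congr 1
  rw [lintegral_indicator hS, setLIntegral_one, Measure.restrict_apply hS]

theorem gaussian_cone' (T : Set (ℝ × ℝ)) (S : Set ℝ) (hT : MeasurableSet T) (hS : MeasurableSet S)
    (h : ∀ r φ : ℝ, 0 < r → ((r * cos φ, r * sin φ) ∈ T ↔ φ ∈ S)) :
    ((gaussianReal 0 1).prod (gaussianReal 0 1)) T =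
      volume (S ∩ Set.Ioo (-π) π) / ENNReal.ofReal (2 * π) := by
  have h1 := gaussian_cone Set.univ Set.univ .univ .univ (by simp)
  rw [gaussian_cone T S hT hS h]
  rw [measure_univ, Set.univ_inter, Real.volume_Ioo, show π - -π = 2 * π by ring] at h1
  have := ENNReal.eq_inv_of_mul_eq_one_left h1.symm
  rw [this, mul_comm, ENNReal.div_eq_inv_mul, mul_comm]

theorem gaussian_wedge (θ : ℝ) (h0 : 0 ≤ θ) (h1 : θ ≤ π) :
    ((gaussianReal 0 1).prod (gaussianReal 0 1))
      {x | 0 ≤ x.1 ∧ 0 ≤ cos θ * x.1 + sin θ * x.2} = ENNReal.ofReal (1 / 2 - θ / (2 * π)) := by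
  rw [gaussian_cone' _ {φ | 0 ≤ cos φ ∧ 0 ≤ cos (φ - θ)}
    (meas_le_and (by fun_prop) (by fun_prop) (by fun_prop) (by fun_prop))
    (meas_le_and (by fun_prop) (by fun_prop) (by fun_prop) (by fun_prop))]
  · have hpi := Real.pi_pos
    have : volume ({φ | 0 ≤ cos φ ∧ 0 ≤ cos (φ - θ)} ∩ Set.Ioo (-π) π) =
        volume (Set.Icc (θ - π / 2) (π / 2)) := by
      apply le_antisymm
      · have hsub : ({φ | 0 ≤ cos φ ∧ 0 ≤ cos (φ - θ)} ∩ Set.Ioo (-π) π) ⊆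
            Set.Icc (θ - π / 2) (π / 2) ∪ {-π/2} := by
          rintro φ ⟨⟨ha, hb⟩, hc, hd⟩
          have h2 : φ ≤ π / 2 := by
            by_contra! hh
            have := Real.cos_neg_of_pi_div_two_lt_of_lt hh (by linarith)
            linarith
          have h3 : -(π / 2) ≤ φ := by
            by_contra! hh
            have := Real.cos_neg_of_pi_div_two_lt_of_lt (x := -φ) (by linarith) (by linarith)
            rw [Real.cos_neg] at this
            linarith
          by_cases h4 : φ = -π/2
          · right; exact h4
          left
          refine ⟨?_, h2⟩
          by_contra! hh
          have h5 : -(π / 2) < φ := lt_of_le_of_ne h3 (fun h => h4 (by rw [← h]; ring))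
          have := Real.cos_neg_of_pi_div_two_lt_of_lt (x := -(φ - θ)) (by linarith) (by linarith)
          rw [Real.cos_neg] at this
          linarith
        calc _ ≤ _ := measure_mono hsub
          _ ≤ _ := measure_union_le _ _
          _ = _ := by simp
      · rw [← MeasureTheory.Ioo_ae_eq_Icc.measure_eq]
        apply measure_mono
        rintro φ ⟨ha, hb⟩
        refine ⟨⟨Real.cos_nonneg_of_neg_pi_div_two_le_of_le (by linarith) (by linarith),
          Real.cos_nonneg_of_neg_pi_div_two_le_of_le (by linarith) (by linarith)⟩, by linarith, by linarith⟩
    rw [this, Real.volume_Icc, ← ENNReal.ofReal_div_of_pos (by positivity)]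
    congr 1
    field_simp
    ring
  · intro r φ hr
    simp only [Set.mem_ofPred_eq]
    rw [mul_nonneg_iff_of_pos_left hr, show cos θ * (r * cos φ) + sin θ * (r * sin φ) =
      r * cos (φ - θ) by rw [Real.cos_sub]; ring, mul_nonneg_iff_of_pos_left hr]

theorem stdGaussian_eq (d : ℕ) :
    _root_.stdGaussian d = ProbabilityTheory.stdGaussian (EuclideanSpace ℝ (Fin d)) :=
  map_pi_eq_stdGaussian

instance stdGaussian_prob (d : ℕ) : IsProbabilityMeasure (_root_.stdGaussian d) := by
  rw [stdGaussian_eq]; infer_instance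

instance sphereUniform_prob (d : ℕ) : IsProbabilityMeasure (sphereUniform d) :=
  Measure.isProbabilityMeasure_map (by fun_prop)

theorem gaussian_orthant_unit {d : ℕ} (u v : EuclideanSpace ℝ (Fin d)) (hu : ‖u‖ = 1)
    (hv : ‖v‖ = 1) :
    _root_.stdGaussian d {x | 0 ≤ ⟪u, x⟫ ∧ 0 ≤ ⟪v, x⟫} =
      ENNReal.ofReal (1 / 2 - Real.arccos ⟪u, v⟫ / (2 * π)) := by
  have hT : MeasurableSet {x : ℝ × ℝ | 0 ≤ x.1 ∧ 0 ≤ x.2} :=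
    meas_le_and (by fun_prop) (by fun_prop) (by fun_prop) (by fun_prop)
  have habs := abs_le.1 ((abs_real_inner_le_norm u v).trans (by rw [hu, hv, mul_one]))
  set θ := Real.arccos ⟪u, v⟫ with hθ
  have hc : cos θ = ⟪u, v⟫ := Real.cos_arccos habs.1 habs.2
  have hlaw := gaussian_pair_law u v (!₂[1, 0] : EuclideanSpace ℝ (Fin 2)) !₂[cos θ, sin θ]
    (by rw [hu, EuclideanSpace.norm_eq]; simp) (by rw [hv, EuclideanSpace.norm_eq]; simp)
    (by rw [← hc]; simp [PiLp.inner_apply])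
  rw [stdGaussian_eq]
  have e1 := congrArg (fun m => m {x : ℝ × ℝ | 0 ≤ x.1 ∧ 0 ≤ x.2}) hlaw
  simp only at e1
  rw [Measure.map_apply (by fun_prop) hT, Measure.map_apply (by fun_prop) hT,
    ← map_pi_eq_stdGaussian (ι := Fin 2), Measure.map_apply (by fun_prop)] at e1
  swap
  · exact hT.preimage (by fun_prop)
  rw [← gaussian_wedge θ (Real.arccos_nonneg _) (Real.arccos_le_pi _)]
  refine Eq.trans e1 ?_
  have mp := measurePreserving_finTwoArrow (gaussianReal 0 1)
  rw [← mp.map_eq, Measure.map_apply (by fun_prop)]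
  · congr 1
    ext x
    simp [PiLp.inner_apply, mul_comm]
  · exact meas_le_and (by fun_prop) (by fun_prop) (by fun_prop) (by fun_prop)

theorem sphere_orthant {d : ℕ} (u v : EuclideanSpace ℝ (Fin d)) (hu : u ≠ 0) (hv : v ≠ 0) :
    (sphereUniform d).real {x | ⟪x, u⟫ ≤ 0 ∧ ⟪x, v⟫ ≤ 0} = 1 / 2 - Ang u v / (2 * π) := by
  have hu' : 0 < ‖u‖ := norm_pos_iff.2 hu
  have hv' : 0 < ‖v‖ := norm_pos_iff.2 hv
  have h := gaussian_orthant_unit (-(‖u‖⁻¹ • u)) (-(‖v‖⁻¹ • v))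
    (by rw [norm_neg, norm_smul, norm_inv, norm_norm, inv_mul_cancel₀ hu'.ne'])
    (by rw [norm_neg, norm_smul, norm_inv, norm_norm, inv_mul_cancel₀ hv'.ne'])
  rw [Measure.real, sphereUniform, Measure.map_apply (by fun_prop)
    (meas_le_and (by fun_prop) (by fun_prop) (by fun_prop) (by fun_prop))]
  have e : (fun x : EuclideanSpace ℝ (Fin d) => ‖x‖⁻¹ • x) ⁻¹' {x | ⟪x, u⟫ ≤ 0 ∧ ⟪x, v⟫ ≤ 0} =
      {x | 0 ≤ ⟪-(‖u‖⁻¹ • u), x⟫ ∧ 0 ≤ ⟪-(‖v‖⁻¹ • v), x⟫} := by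
    ext x
    simp only [Set.mem_preimage, Set.mem_ofPred_eq, inner_neg_left, real_inner_smul_left,
      neg_nonneg]
    rcases eq_or_ne x 0 with rfl | hx
    · simp
    have hx' : 0 < ‖x‖⁻¹ := inv_pos.2 (norm_pos_iff.2 hx)
    have hu'' : 0 < ‖u‖⁻¹ := inv_pos.2 hu'
    have hv'' : 0 < ‖v‖⁻¹ := inv_pos.2 hv'
    rw [mul_nonpos_iff_pos_imp_nonpos, mul_nonpos_iff_pos_imp_nonpos, mul_nonpos_iff_pos_imp_nonpos, mul_nonpos_iff_pos_imp_nonpos]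
    simp only [hx', hu'', hv'', real_inner_comm x]
    constructor <;> intro h <;> constructor <;> constructor <;> intros <;> simp_all
  rw [e, h, ENNReal.toReal_ofReal]
  · rw [Ang]
    congr 3
    rw [inner_neg_neg, real_inner_smul_left, real_inner_smul_right]
    field_simp
  · have := Real.arccos_le_pi ⟪-(‖u‖⁻¹ • u), -(‖v‖⁻¹ • v)⟫
    have hpi := Real.pi_pos
    rw [sub_nonneg, div_le_div_iff₀ (by positivity) (by positivity)]
    linarith

/-- Measurable functions with values in `[0,1]`. -/
structure UnitFun {X : Type*} [MeasurableSpace X] (f : X → ℝ) : Prop where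
  meas : Measurable f
  nonneg : ∀ x, 0 ≤ f x
  le_one : ∀ x, f x ≤ 1

namespace UnitFun

variable {X Y W V : Type*} [MeasurableSpace X] [MeasurableSpace Y] [MeasurableSpace W]
  [MeasurableSpace V]

theorem integrable {f : X → ℝ} (hf : UnitFun f) (ν : Measure X) [IsProbabilityMeasure ν] :
    Integrable f ν :=
  Integrable.of_bound hf.meas.aestronglyMeasurable 1
    (Filter.Eventually.of_forall fun x => by
      rw [Real.norm_eq_abs, abs_of_nonneg (hf.nonneg x)]; exact hf.le_one x)

theorem mul {f g : X → ℝ} (hf : UnitFun f) (hg : UnitFun g) : UnitFun (fun x => f x * g x) :=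
  ⟨hf.meas.mul hg.meas, fun x => mul_nonneg (hf.nonneg x) (hg.nonneg x),
    fun x => mul_le_one₀ (hf.le_one x) (hg.nonneg x) (hg.le_one x)⟩

theorem comp {f : Y → ℝ} (hf : UnitFun f) {g : X → Y} (hg : Measurable g) :
    UnitFun (fun x => f (g x)) :=
  ⟨hf.meas.comp hg, fun _ => hf.nonneg _, fun _ => hf.le_one _⟩

theorem comp3 {f : X → Y → W → ℝ} (hf : UnitFun (fun t : X × Y × W => f t.1 t.2.1 t.2.2))
    {a : V → X} {b : V → Y} {c : V → W} (ha : Measurable a) (hb : Measurable b)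
    (hc : Measurable c) : UnitFun (fun t => f (a t) (b t) (c t)) :=
  hf.comp (g := fun t => (a t, b t, c t)) (by fun_prop)

theorem int {f : X → Y → ℝ} (hf : UnitFun (fun t : X × Y => f t.1 t.2)) (ν : Measure Y)
    [IsProbabilityMeasure ν] : UnitFun (fun x => ∫ y, f x y ∂ν) := by
  refine ⟨?_, fun x => integral_nonneg fun y => hf.nonneg (x, y), fun x => ?_⟩
  · exact (hf.meas.stronglyMeasurable.integral_prod_right' (ν := ν)).measurable
  · have h : UnitFun (fun y => f x y) := hf.comp (g := fun y => (x, y)) (by fun_prop)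
    calc ∫ y, f x y ∂ν ≤ ∫ y, (1 : ℝ) ∂ν :=
          integral_mono (h.integrable ν) (integrable_const _) fun y => h.le_one y
      _ = 1 := by simp

theorem coll {f : X → Y → ℝ} (hf : UnitFun (fun t : X × Y => f t.1 t.2)) (κ : Measure X)
    (ν : Measure Y) [IsProbabilityMeasure κ] [IsProbabilityMeasure ν] :
    ∫ x, ∫ y, f x y ∂ν ∂κ = ∫ t, f t.1 t.2 ∂(κ.prod ν) :=
  (integral_prod (fun t : X × Y => f t.1 t.2) (hf.integrable _)).symm

theorem swap {f : X → Y → ℝ} (hf : UnitFun (fun t : X × Y => f t.1 t.2)) (κ : Measure X)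
    (ν : Measure Y) [IsProbabilityMeasure κ] [IsProbabilityMeasure ν] :
    ∫ x, ∫ y, f x y ∂ν ∂κ = ∫ y, ∫ x, f x y ∂κ ∂ν :=
  integral_integral_swap (hf.integrable _)

theorem swap3 {f : X → Y → W → ℝ} (hf : UnitFun (fun t : X × Y × W => f t.1 t.2.1 t.2.2))
    (κ : Measure X) (ν : Measure Y) (ρ : Measure W) [IsProbabilityMeasure κ]
    [IsProbabilityMeasure ν] [IsProbabilityMeasure ρ] :
    ∫ x, ∫ y, ∫ w, f x y w ∂ρ ∂ν ∂κ = ∫ w, ∫ y, ∫ x, f x y w ∂κ ∂ν ∂ρ := by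
  have h1 : ∀ x, ∫ y, ∫ w, f x y w ∂ρ ∂ν = ∫ w, ∫ y, f x y w ∂ν ∂ρ := fun x =>
    swap (hf.comp3 (by fun_prop) (by fun_prop) (by fun_prop)) ν ρ
  simp only [h1]
  rw [swap (f := fun x w => ∫ y, f x y w ∂ν)]
  · congr 1
    ext w
    exact swap (hf.comp (g := fun t : X × Y => (t.1, t.2, w)) (by fun_prop)) κ ν
  · refine int ?_ ν
    exact hf.comp (g := fun t : (X × W) × Y => (t.1.1, t.2, t.1.2)) (by fun_prop)

theorem swap5 {Z : Type*} [MeasurableSpace Z] {f : X → Y → Z → Z → W → ℝ}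
    (hf : UnitFun (fun t : X × Y × Z × Z × W => f t.1 t.2.1 t.2.2.1 t.2.2.2.1 t.2.2.2.2))
    (κ : Measure X) (ν : Measure Y) (μ : Measure Z) (ρ : Measure W) [IsProbabilityMeasure κ]
    [IsProbabilityMeasure ν] [IsProbabilityMeasure ρ] [IsProbabilityMeasure μ] :
    ∫ a, ∫ b, ∫ x, ∫ y, ∫ w, f a b x y w ∂ρ ∂μ ∂μ ∂ν ∂κ =
      ∫ w, ∫ x, ∫ y, ∫ a, ∫ b, f a b x y w ∂ν ∂κ ∂μ ∂μ ∂ρ := by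
  have s1 : ∀ a b, ∫ x, ∫ y, ∫ w, f a b x y w ∂ρ ∂μ ∂μ =
      ∫ m, ∫ w, f a b m.1 m.2 w ∂ρ ∂(μ.prod μ) := fun a b =>
    coll (int (hf.comp (g := fun t : (Z × Z) × W => (a, b, t.1.1, t.1.2, t.2)) (by fun_prop)) ρ) μ μ
  simp only [s1]
  rw [coll (f := fun a b => ∫ m, ∫ w, f a b m.1 m.2 w ∂ρ ∂(μ.prod μ))]
  swap
  · refine int (int ?_ _) _
    exact hf.comp (g := fun t : ((X × Y) × (Z × Z)) × W =>
      (t.1.1.1, t.1.1.2, t.1.2.1, t.1.2.2, t.2)) (by fun_prop)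
  rw [swap3 (f := fun (p : X × Y) (m : Z × Z) (w : W) => f p.1 p.2 m.1 m.2 w)]
  swap
  · exact hf.comp (g := fun t : (X × Y) × (Z × Z) × W =>
      (t.1.1, t.1.2, t.2.1.1, t.2.1.2, t.2.2)) (by fun_prop)
  congr 1
  ext w
  have s2 : ∀ x y, ∫ a, ∫ b, f a b x y w ∂ν ∂κ = ∫ p, f p.1 p.2 x y w ∂(κ.prod ν) := fun x y =>
    coll (hf.comp (g := fun t : X × Y => (t.1, t.2, x, y, w)) (by fun_prop)) κ ν
  simp only [s2]
  rw [coll (f := fun x y => ∫ p, f p.1 p.2 x y w ∂(κ.prod ν))]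
  refine int ?_ _
  exact hf.comp (g := fun t : (Z × Z) × (X × Y) =>
      (t.2.1, t.2.2, t.1.1, t.1.2, w)) (by fun_prop)

end UnitFun

theorem integral_mul_integral {X Y : Type*} [MeasurableSpace X] [MeasurableSpace Y]
    (κ : Measure X) (ν : Measure Y) (f : X → ℝ) (g : Y → ℝ) :
    ∫ x, ∫ y, f x * g y ∂ν ∂κ = (∫ x, f x ∂κ) * ∫ y, g y ∂ν := by
  simp only [integral_const_mul, integral_mul_const]

theorem abstract_bkr {X Y Z : Type*} [MeasurableSpace X] [MeasurableSpace Y] [MeasurableSpace Z]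
    (κ : Measure X) (ν : Measure Y) (μ : Measure Z) [IsProbabilityMeasure κ]
    [IsProbabilityMeasure ν] [IsProbabilityMeasure μ] (A : X → Z → Z → ℝ) (B : Y → Z → Z → ℝ)
    (hA : UnitFun (fun t : X × Z × Z => A t.1 t.2.1 t.2.2))
    (hB : UnitFun (fun t : Y × Z × Z => B t.1 t.2.1 t.2.2))
    (K L : Z → Z → Z → ℝ) (hK : ∀ z1 z2 x, K z1 z2 x = ∫ a, A a z1 x * A a z2 x ∂κ)
    (hL : ∀ z1 z2 x, L z1 z2 x = ∫ b, B b z1 x * B b z2 x ∂ν) :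
    ∫ a, ∫ b, ∫ x, ∫ y, ((∫ z, A a z x * B b z y ∂μ) - (∫ z, A a z x ∂μ) * (∫ z, B b z y ∂μ)) ^ 2
      ∂μ ∂μ ∂ν ∂κ =
    (∫ z1, ∫ z2, ∫ z3, ∫ z4, K z1 z2 z3 * L z1 z2 z4 ∂μ ∂μ ∂μ ∂μ)
    + (∫ z1, ∫ z2, ∫ z3, ∫ z4, ∫ z5, ∫ z6, K z1 z2 z5 * L z3 z4 z6 ∂μ ∂μ ∂μ ∂μ ∂μ ∂μ)
    - 2 * (∫ z1, ∫ z2, ∫ z3, ∫ z4, ∫ z5, K z1 z2 z4 * L z1 z3 z5 ∂μ ∂μ ∂μ ∂μ ∂μ) := by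
  -- the three terms
  have hJ : UnitFun (fun t : (X × Y) × (Z × Z) => ∫ z, A t.1.1 z t.2.1 * B t.1.2 z t.2.2 ∂μ) :=
    by
    repeat' first
      | refine UnitFun.mul ?_ ?_
      | refine UnitFun.int ?_ _
      | refine hA.comp3 ?_ ?_ ?_
      | refine hB.comp3 ?_ ?_ ?_
      | fun_prop
  have hI : UnitFun (fun t : (X × Y) × (Z × Z) => ∫ z, A t.1.1 z t.2.1 ∂μ) :=
    by
    repeat' first
      | refine UnitFun.mul ?_ ?_
      | refine UnitFun.int ?_ _
      | refine hA.comp3 ?_ ?_ ?_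
      | refine hB.comp3 ?_ ?_ ?_
      | fun_prop
  have hH : UnitFun (fun t : (X × Y) × (Z × Z) => ∫ z, B t.1.2 z t.2.2 ∂μ) :=
    by
    repeat' first
      | refine UnitFun.mul ?_ ?_
      | refine UnitFun.int ?_ _
      | refine hA.comp3 ?_ ?_ ?_
      | refine hB.comp3 ?_ ?_ ?_
      | fun_prop
  -- collapsing four iterated integrals
  have c4 : ∀ g : (X × Y) × (Z × Z) → ℝ, Measurable g → (∃ C, ∀ t, ‖g t‖ ≤ C) →
      ∫ a, ∫ b, ∫ x, ∫ y, g ((a, b), (x, y)) ∂μ ∂μ ∂ν ∂κ =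
        ∫ t, g t ∂((κ.prod ν).prod (μ.prod μ)) := by
    rintro g hg ⟨C, hC⟩
    have int1 : Integrable g ((κ.prod ν).prod (μ.prod μ)) :=
      Integrable.of_bound hg.aestronglyMeasurable C (Filter.Eventually.of_forall hC)
    rw [integral_prod _ int1, integral_prod _ int1.integral_prod_left]
    congr 1; ext a; congr 1; ext b
    rw [integral_prod]
    exact Integrable.of_bound (hg.comp (by fun_prop)).aestronglyMeasurable C
      (Filter.Eventually.of_forall fun t => hC _)
  have c4' : ∀ g : (X × Y) × (Z × Z) → ℝ, UnitFun g →
      ∫ a, ∫ b, ∫ x, ∫ y, g ((a, b), (x, y)) ∂μ ∂μ ∂ν ∂κ =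
        ∫ t, g t ∂((κ.prod ν).prod (μ.prod μ)) := fun g hg => c4 g hg.meas
      ⟨1, fun t => by rw [Real.norm_eq_abs, abs_of_nonneg (hg.nonneg t)]; exact hg.le_one t⟩
  have hJJ := hJ.mul hJ
  have hII := (hI.mul hI).mul (hH.mul hH)
  have hJI := (hJ.mul hI).mul hH
  have split : ∫ a, ∫ b, ∫ x, ∫ y,
      ((∫ z, A a z x * B b z y ∂μ) - (∫ z, A a z x ∂μ) * (∫ z, B b z y ∂μ)) ^ 2 ∂μ ∂μ ∂ν ∂κ =
      (∫ a, ∫ b, ∫ x, ∫ y, (∫ z, A a z x * B b z y ∂μ) * (∫ z, A a z x * B b z y ∂μ) ∂μ ∂μ ∂ν ∂κ)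
      + (∫ a, ∫ b, ∫ x, ∫ y, ((∫ z, A a z x ∂μ) * (∫ z, A a z x ∂μ)) *
          ((∫ z, B b z y ∂μ) * (∫ z, B b z y ∂μ)) ∂μ ∂μ ∂ν ∂κ)
      - 2 * (∫ a, ∫ b, ∫ x, ∫ y, (∫ z, A a z x * B b z y ∂μ) * (∫ z, A a z x ∂μ) *
          (∫ z, B b z y ∂μ) ∂μ ∂μ ∂ν ∂κ) := by
    have e1 := c4' _ hJJ
    have e2 := c4' _ hII
    have e3 := c4' _ hJI
    have e0 := c4 (fun t => ((∫ z, A t.1.1 z t.2.1 * B t.1.2 z t.2.2 ∂μ) -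
      (∫ z, A t.1.1 z t.2.1 ∂μ) * (∫ z, B t.1.2 z t.2.2 ∂μ)) ^ 2)
      ((hJ.meas.sub (hI.meas.mul hH.meas)).pow_const 2) ⟨1, fun t => by
        have h1 := hJ.nonneg t
        have h2 := hJ.le_one t
        have h3 := (hI.mul hH).nonneg t
        have h4 := (hI.mul hH).le_one t
        rw [Real.norm_eq_abs, abs_of_nonneg (sq_nonneg _), sq_le_one_iff_abs_le_one, abs_le]
        constructor <;> linarith⟩
    simp only at e0 e1 e2 e3
    rw [e0, e1, e2, e3, ← integral_const_mul, ← integral_add (hJJ.integrable _) (hII.integrable _),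
      ← integral_sub]
    · congr 1
      ext t
      ring
    · exact (hJJ.integrable _).add (hII.integrable _)
    · exact (hJI.integrable _).const_mul 2
  rw [split]
  congr 1
  · congr 1
    · -- first term
      have hF : UnitFun (fun t : X × Y × Z × Z × (Z × Z) =>
          (A t.1 t.2.2.2.2.1 t.2.2.1 * B t.2.1 t.2.2.2.2.1 t.2.2.2.1) *
          (A t.1 t.2.2.2.2.2 t.2.2.1 * B t.2.1 t.2.2.2.2.2 t.2.2.2.1)) :=
      by
        repeat' first
          | refine UnitFun.mul ?_ ?_
          | refine UnitFun.int ?_ _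
          | refine hA.comp3 ?_ ?_ ?_
          | refine hB.comp3 ?_ ?_ ?_
          | fun_prop
      have e1 : ∀ a b x y, (∫ z, A a z x * B b z y ∂μ) * (∫ z, A a z x * B b z y ∂μ) =
          ∫ w, (A a w.1 x * B b w.1 y) * (A a w.2 x * B b w.2 y) ∂(μ.prod μ) := fun a b x y =>
        (integral_prod_mul (fun z => A a z x * B b z y) (fun z => A a z x * B b z y)).symm
      simp only [e1]
      rw [UnitFun.swap5 (f := fun a b x y (w : Z × Z) =>
        (A a w.1 x * B b w.1 y) * (A a w.2 x * B b w.2 y)) hF]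
      have e2 : ∀ (w : Z × Z) x y, ∫ a, ∫ b, (A a w.1 x * B b w.1 y) * (A a w.2 x * B b w.2 y) ∂ν ∂κ
          = K w.1 w.2 x * L w.1 w.2 y := by
        intro w x y
        rw [hK, hL, ← integral_mul_integral]
        congr 1; ext a; congr 1; ext b; ring
      have hKL : UnitFun (fun w : Z × Z => ∫ x, ∫ y, K w.1 w.2 x * L w.1 w.2 y ∂μ ∂μ) := by
        simp only [hK, hL]
        repeat' first | refine UnitFun.mul ?_ ?_ | refine UnitFun.int ?_ _ | refine hA.comp3 ?_ ?_ ?_ | refine hB.comp3 ?_ ?_ ?_ | fun_prop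
      simp only [e2]
      exact (UnitFun.coll (f := fun z1 z2 => ∫ x, ∫ y, K z1 z2 x * L z1 z2 y ∂μ ∂μ) hKL μ μ).symm
    · -- second term
      have r : ∫ z1, ∫ z2, ∫ z3, ∫ z4, ∫ z5, ∫ z6, K z1 z2 z5 * L z3 z4 z6 ∂μ ∂μ ∂μ ∂μ ∂μ ∂μ =
          (∫ z1, ∫ z2, ∫ z5, K z1 z2 z5 ∂μ ∂μ ∂μ) * (∫ z3, ∫ z4, ∫ z6, L z3 z4 z6 ∂μ ∂μ ∂μ) := by
        simp only [integral_const_mul, integral_mul_const]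
      have l : ∫ a, ∫ b, ∫ x, ∫ y, ((∫ z, A a z x ∂μ) * (∫ z, A a z x ∂μ)) *
          ((∫ z, B b z y ∂μ) * (∫ z, B b z y ∂μ)) ∂μ ∂μ ∂ν ∂κ =
          (∫ a, ∫ x, (∫ z, A a z x ∂μ) * (∫ z, A a z x ∂μ) ∂μ ∂κ) *
          (∫ b, ∫ y, (∫ z, B b z y ∂μ) * (∫ z, B b z y ∂μ) ∂μ ∂ν) := by
        simp only [integral_const_mul, integral_mul_const]
      have gen : ∀ {X' : Type _} [MeasurableSpace X'] (κ' : Measure X') [IsProbabilityMeasure κ']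
          (A' : X' → Z → Z → ℝ) (K' : Z → Z → Z → ℝ),
          UnitFun (fun t : X' × Z × Z => A' t.1 t.2.1 t.2.2) →
          (∀ z1 z2 x, K' z1 z2 x = ∫ a, A' a z1 x * A' a z2 x ∂κ') →
          ∫ a, ∫ x, (∫ z, A' a z x ∂μ) * (∫ z, A' a z x ∂μ) ∂μ ∂κ' =
          ∫ z1, ∫ z2, ∫ z5, K' z1 z2 z5 ∂μ ∂μ ∂μ := by
        intro X' _ κ' _ A' K' hA' hK'
        have e1 : ∀ a x, (∫ z, A' a z x ∂μ) * (∫ z, A' a z x ∂μ) =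
            ∫ w, A' a w.1 x * A' a w.2 x ∂(μ.prod μ) := fun a x =>
          (integral_prod_mul (fun z => A' a z x) (fun z => A' a z x)).symm
        simp only [e1]
        rw [UnitFun.swap3 (f := fun a x (w : Z × Z) => A' a w.1 x * A' a w.2 x)]
        · have hKL : UnitFun (fun w : Z × Z => ∫ x, K' w.1 w.2 x ∂μ) := by
            simp only [hK']
            repeat' first | refine UnitFun.mul ?_ ?_ | refine UnitFun.int ?_ _ |  refine hA'.comp3 ?_ ?_ ?_ | fun_prop
          simp only [← hK']
          exact (UnitFun.coll (f := fun z1 z2 => ∫ x, K' z1 z2 x ∂μ) hKL μ μ).symm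
        · repeat' first | refine UnitFun.mul ?_ ?_ | refine UnitFun.int ?_ _ |  refine hA'.comp3 ?_ ?_ ?_ | fun_prop
      rw [r, l, gen κ A K hA hK]
      congr 1
      -- same for the other factor
      have e1 : ∀ a x, (∫ z, B a z x ∂μ) * (∫ z, B a z x ∂μ) =
          ∫ w, B a w.1 x * B a w.2 x ∂(μ.prod μ) := fun a x =>
        (integral_prod_mul (fun z => B a z x) (fun z => B a z x)).symm
      simp only [e1]
      rw [UnitFun.swap3 (f := fun a x (w : Z × Z) => B a w.1 x * B a w.2 x)]
      · have hKL : UnitFun (fun w : Z × Z => ∫ x, L w.1 w.2 x ∂μ) := by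
          simp only [hL]
          repeat' first | refine UnitFun.mul ?_ ?_ | refine UnitFun.int ?_ _ | refine hA.comp3 ?_ ?_ ?_ | refine hB.comp3 ?_ ?_ ?_ | fun_prop
        simp only [← hL]
        exact (UnitFun.coll (f := fun z1 z2 => ∫ x, L z1 z2 x ∂μ) hKL μ μ).symm
      · repeat' first | refine UnitFun.mul ?_ ?_ | refine UnitFun.int ?_ _ | refine hA.comp3 ?_ ?_ ?_ | refine hB.comp3 ?_ ?_ ?_ | fun_prop
  · -- third term
    congr 1
    have hF : UnitFun (fun t : X × Y × Z × Z × (Z × Z × Z) =>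
        (A t.1 t.2.2.2.2.1 t.2.2.1 * B t.2.1 t.2.2.2.2.1 t.2.2.2.1) *
        (A t.1 t.2.2.2.2.2.1 t.2.2.1 * B t.2.1 t.2.2.2.2.2.2 t.2.2.2.1)) := by
      repeat' first | refine UnitFun.mul ?_ ?_ | refine UnitFun.int ?_ _ | refine hA.comp3 ?_ ?_ ?_ | refine hB.comp3 ?_ ?_ ?_ | fun_prop
    have e1 : ∀ a b x y, (∫ z, A a z x * B b z y ∂μ) * (∫ z, A a z x ∂μ) * (∫ z, B b z y ∂μ) =
        ∫ w, (A a w.1 x * B b w.1 y) * (A a w.2.1 x * B b w.2.2 y) ∂(μ.prod (μ.prod μ)) := by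
      intro a b x y
      rw [integral_prod_mul (fun z => A a z x * B b z y) (fun w : Z × Z => A a w.1 x * B b w.2 y),
        integral_prod_mul (fun z => A a z x) (fun z => B b z y), mul_assoc]
    simp only [e1]
    rw [UnitFun.swap5 (f := fun a b x y (w : Z × Z × Z) =>
      (A a w.1 x * B b w.1 y) * (A a w.2.1 x * B b w.2.2 y)) hF]
    have e2 : ∀ (w : Z × Z × Z) x y,
        ∫ a, ∫ b, (A a w.1 x * B b w.1 y) * (A a w.2.1 x * B b w.2.2 y) ∂ν ∂κ
        = K w.1 w.2.1 x * L w.1 w.2.2 y := by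
      intro w x y
      rw [hK, hL, ← integral_mul_integral]
      congr 1; ext a; congr 1; ext b; ring
    have hKL : UnitFun (fun w : Z × Z × Z => ∫ x, ∫ y, K w.1 w.2.1 x * L w.1 w.2.2 y ∂μ ∂μ) := by
      simp only [hK, hL]
      repeat' first | refine UnitFun.mul ?_ ?_ | refine UnitFun.int ?_ _ | refine hA.comp3 ?_ ?_ ?_ | refine hB.comp3 ?_ ?_ ?_ | fun_prop
    simp only [e2]
    rw [← UnitFun.coll (f := fun z1 (w : Z × Z) => ∫ x, ∫ y, K z1 w.1 x * L z1 w.2 y ∂μ ∂μ) hKL]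
    congr 1
    ext z1
    exact (UnitFun.coll (f := fun z2 z3 => ∫ x, ∫ y, K z1 z2 x * L z1 z3 y ∂μ ∂μ)
      (hKL.comp (g := fun t : Z × Z => (z1, t.1, t.2)) (by fun_prop)) μ μ).symm

/-- Indicator of `s ≤ u`. -/
def leInd (s u : ℝ) : ℝ := if s ≤ u then 1 else 0

theorem leInd_unit : UnitFun (fun t : ℝ × ℝ => leInd t.1 t.2) := by
  refine ⟨?_, fun t => ?_, fun t => ?_⟩
  · exact Measurable.ite (measurableSet_le (by fun_prop) (by fun_prop)) (by fun_prop) (by fun_prop)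
  · simp only [leInd]; split_ifs <;> norm_num
  · simp only [leInd]; split_ifs <;> norm_num

theorem leInd_comp {V : Type*} [MeasurableSpace V] {a b : V → ℝ} (ha : Measurable a)
    (hb : Measurable b) : UnitFun (fun t => leInd (a t) (b t)) :=
  leInd_unit.comp (g := fun t => (a t, b t)) (by fun_prop)

theorem measure_eq_leInd {Z : Type*} [MeasurableSpace Z] (μ : Measure Z) (f : Z → ℝ)
    (hf : Measurable f) (u : ℝ) : (μ {z | f z ≤ u}).toReal = ∫ z, leInd (f z) u ∂μ := by
  have hS : MeasurableSet {z | f z ≤ u} := measurableSet_le hf (by fun_prop)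
  rw [← Measure.real, ← integral_indicator_one hS]
  congr 1

theorem measure_eq_leInd2 {Z : Type*} [MeasurableSpace Z] (μ : Measure Z) (f g : Z → ℝ)
    (hf : Measurable f) (hg : Measurable g) (u v : ℝ) :
    (μ {z | f z ≤ u ∧ g z ≤ v}).toReal = ∫ z, leInd (f z) u * leInd (g z) v ∂μ := by
  have hS : MeasurableSet {z | f z ≤ u ∧ g z ≤ v} := meas_le_and hf (by fun_prop) hg (by fun_prop)
  rw [← Measure.real, ← integral_indicator_one hS]
  congr 1
  ext z
  by_cases h1 : f z ≤ u <;> by_cases h2 : g z ≤ v <;> simp [leInd, Set.indicator, h1, h2]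

theorem angle_integral {d : ℕ} (a b c : EuclideanSpace ℝ (Fin d)) (h1 : a ≠ c) (h2 : b ≠ c) :
    ∫ α, leInd ⟪α, a⟫ ⟪α, c⟫ * leInd ⟪α, b⟫ ⟪α, c⟫ ∂(sphereUniform d) =
      1 / 2 - Ang (a - c) (b - c) / (2 * π) := by
  rw [← sphere_orthant _ _ (sub_ne_zero.2 h1) (sub_ne_zero.2 h2)]
  have hS : MeasurableSet {x : EuclideanSpace ℝ (Fin d) | ⟪x, a - c⟫ ≤ 0 ∧ ⟪x, b - c⟫ ≤ 0} :=
    meas_le_and (by fun_prop) (by fun_prop) (by fun_prop) (by fun_prop)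
  rw [← integral_indicator_one hS]
  congr 1
  ext z
  by_cases h1 : ⟪z, a⟫ ≤ ⟪z, c⟫ <;> by_cases h2 : ⟪z, b⟫ ≤ ⟪z, c⟫ <;>
    simp [leInd, Set.indicator, h1, h2, inner_sub_right]

/-- Theorem 7.2, projection-averaged Blum–Kiefer–Rosenblatt coefficient:
for a joint law `μ` on `ℝ^p × ℝ^q` with `P(X₁ = X₂) = 0` and `P(Y₁ = Y₂) = 0`,
`∫_{S^{p-1}} ∫_{S^{q-1}} ∫∫ [F_{α,β}(u,v) - F_α(u) G_β(v)]² dμ_α(u) dν_β(v) dλ_q(β) dλ_p(α)`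
equals the combination of three expectations of products of angle terms, with
`(X₁,Y₁),…,(X₆,Y₆)` i.i.d. from `μ` (expectations written as iterated integrals). -/
theorem stmt17 {p q : ℕ}
    (μ : Measure (EuclideanSpace ℝ (Fin p) × EuclideanSpace ℝ (Fin q)))
    [IsProbabilityMeasure μ]
    (hX : (μ.prod μ) {w | w.1.1 = w.2.1} = 0)
    (hY : (μ.prod μ) {w | w.1.2 = w.2.2} = 0) :
    (∫ α, ∫ β, ∫ u, ∫ v,
        ((μ {z | ⟪α, z.1⟫ ≤ u ∧ ⟪β, z.2⟫ ≤ v}).toReal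
          - (μ {z | ⟪α, z.1⟫ ≤ u}).toReal * (μ {z | ⟪β, z.2⟫ ≤ v}).toReal) ^ 2
      ∂(μ.map fun z => ⟪β, z.2⟫) ∂(μ.map fun z => ⟪α, z.1⟫)
      ∂(sphereUniform q) ∂(sphereUniform p))
    = (∫ z1, ∫ z2, ∫ z3, ∫ z4, ∫ z5, ∫ z6,
          (1 / 2 - Ang (z1.1 - z3.1) (z2.1 - z3.1) / (2 * π))
            * (1 / 2 - Ang (z1.2 - z4.2) (z2.2 - z4.2) / (2 * π)) ∂μ ∂μ ∂μ ∂μ ∂μ ∂μ)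
      + (∫ z1, ∫ z2, ∫ z3, ∫ z4, ∫ z5, ∫ z6,
          (1 / 2 - Ang (z1.1 - z5.1) (z2.1 - z5.1) / (2 * π))
            * (1 / 2 - Ang (z3.2 - z6.2) (z4.2 - z6.2) / (2 * π)) ∂μ ∂μ ∂μ ∂μ ∂μ ∂μ)
      - 2 * (∫ z1, ∫ z2, ∫ z3, ∫ z4, ∫ z5, ∫ z6,
          (1 / 2 - Ang (z1.1 - z4.1) (z2.1 - z4.1) / (2 * π))
            * (1 / 2 - Ang (z1.2 - z5.2) (z3.2 - z5.2) / (2 * π)) ∂μ ∂μ ∂μ ∂μ ∂μ ∂μ) := by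
  have mX : ∀ α : EuclideanSpace ℝ (Fin p), Measurable
      (fun z : EuclideanSpace ℝ (Fin p) × EuclideanSpace ℝ (Fin q) => ⟪α, z.1⟫) := fun α => by
    fun_prop
  have mY : ∀ β : EuclideanSpace ℝ (Fin q), Measurable
      (fun z : EuclideanSpace ℝ (Fin p) × EuclideanSpace ℝ (Fin q) => ⟪β, z.2⟫) := fun β => by
    fun_prop
  have step : ∀ (α : EuclideanSpace ℝ (Fin p)) (β : EuclideanSpace ℝ (Fin q)),
      (∫ u, ∫ v, ((μ {z | ⟪α, z.1⟫ ≤ u ∧ ⟪β, z.2⟫ ≤ v}).toReal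
          - (μ {z | ⟪α, z.1⟫ ≤ u}).toReal * (μ {z | ⟪β, z.2⟫ ≤ v}).toReal) ^ 2
      ∂(μ.map fun z => ⟪β, z.2⟫) ∂(μ.map fun z => ⟪α, z.1⟫)) =
      ∫ x, ∫ y, ((∫ z, leInd ⟪α, z.1⟫ ⟪α, x.1⟫ * leInd ⟪β, z.2⟫ ⟪β, y.2⟫ ∂μ) -
        (∫ z, leInd ⟪α, z.1⟫ ⟪α, x.1⟫ ∂μ) * (∫ z, leInd ⟪β, z.2⟫ ⟪β, y.2⟫ ∂μ)) ^ 2 ∂μ ∂μ := by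
    intro α β
    simp only [measure_eq_leInd μ _ (mX α), measure_eq_leInd μ _ (mY β),
      measure_eq_leInd2 μ _ _ (mX α) (mY β)]
    have k1 : UnitFun (fun t : ℝ × ℝ =>
        ∫ z, leInd ⟪α, z.1⟫ t.1 * leInd ⟪β, z.2⟫ t.2 ∂μ) := by
      refine .int ?_ μ
      refine .mul ?_ ?_
      · exact leInd_comp (by fun_prop) (by fun_prop)
      · exact leInd_comp (by fun_prop) (by fun_prop)
    have k2 : UnitFun (fun t : ℝ × ℝ => ∫ z, leInd ⟪α, z.1⟫ t.1 ∂μ) := by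
      refine .int ?_ μ
      exact leInd_comp (by fun_prop) (by fun_prop)
    have k3 : UnitFun (fun t : ℝ × ℝ => ∫ z, leInd ⟪β, z.2⟫ t.2 ∂μ) := by
      refine .int ?_ μ
      exact leInd_comp (by fun_prop) (by fun_prop)
    have hG : Measurable (fun t : ℝ × ℝ =>
        ((∫ z, leInd ⟪α, z.1⟫ t.1 * leInd ⟪β, z.2⟫ t.2 ∂μ) -
        (∫ z, leInd ⟪α, z.1⟫ t.1 ∂μ) * (∫ z, leInd ⟪β, z.2⟫ t.2 ∂μ)) ^ 2) :=
      (k1.meas.sub (k2.meas.mul k3.meas)).pow_const 2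
    have : IsProbabilityMeasure (μ.map fun z => ⟪β, z.2⟫) :=
      Measure.isProbabilityMeasure_map (mY β).aemeasurable
    rw [integral_map (mX α).aemeasurable]
    · congr 1
      ext x
      rw [integral_map (mY β).aemeasurable]
      exact (hG.comp (measurable_prodMk_left (x := ⟪α, x.1⟫))).aestronglyMeasurable
    · exact (hG.stronglyMeasurable.integral_prod_right'
        (ν := μ.map fun z => ⟪β, z.2⟫)).aestronglyMeasurable
  simp only [step]
  have main := abstract_bkr (sphereUniform p) (sphereUniform q) μ
    (fun α z x => leInd ⟪α, z.1⟫ ⟪α, x.1⟫) (fun β z y => leInd ⟪β, z.2⟫ ⟪β, y.2⟫)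
    (leInd_comp (by fun_prop) (by fun_prop)) (leInd_comp (by fun_prop) (by fun_prop))
    (fun z1 z2 x => ∫ α, leInd ⟪α, z1.1⟫ ⟪α, x.1⟫ * leInd ⟪α, z2.1⟫ ⟪α, x.1⟫ ∂(sphereUniform p))
    (fun z1 z2 x => ∫ β, leInd ⟪β, z1.2⟫ ⟪β, x.2⟫ * leInd ⟪β, z2.2⟫ ⟪β, x.2⟫ ∂(sphereUniform q))
    (fun _ _ _ => rfl) (fun _ _ _ => rfl)
  rw [main]
  have hX' : ∀ᵐ z1 ∂μ, ∀ᵐ z2 ∂μ, z1.1 ≠ z2.1 := by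
    have h : ∀ᵐ w ∂(μ.prod μ), w.1.1 ≠ w.2.1 := by
      rw [ae_iff]
      simpa using hX
    exact Measure.ae_ae_of_ae_prod h
  have hY' : ∀ᵐ z1 ∂μ, ∀ᵐ z2 ∂μ, z1.2 ≠ z2.2 := by
    have h : ∀ᵐ w ∂(μ.prod μ), w.1.2 ≠ w.2.2 := by
      rw [ae_iff]
      simpa using hY
    exact Measure.ae_ae_of_ae_prod h
  simp only [integral_const, probReal_univ, one_smul]
  congr 1
  · congr 1
    · apply integral_congr_ae
      filter_upwards [hX', hY'] with z1 x1 y1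
      apply integral_congr_ae
      filter_upwards [hX', hY'] with z2 x2 y2
      apply integral_congr_ae
      filter_upwards [x1, x2] with z3 x13 x23
      apply integral_congr_ae
      filter_upwards [y1, y2] with z4 y14 y24
      rw [angle_integral _ _ _ x13 x23, angle_integral _ _ _ y14 y24]
    · apply integral_congr_ae
      filter_upwards [hX'] with z1 x1
      apply integral_congr_ae
      filter_upwards [hX'] with z2 x2
      apply integral_congr_ae
      filter_upwards [hY'] with z3 y3
      apply integral_congr_ae
      filter_upwards [hY'] with z4 y4
      apply integral_congr_ae
      filter_upwards [x1, x2] with z5 x15 x25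
      apply integral_congr_ae
      filter_upwards [y3, y4] with z6 y36 y46
      rw [angle_integral _ _ _ x15 x25, angle_integral _ _ _ y36 y46]
  · congr 1
    apply integral_congr_ae
    filter_upwards [hX', hY'] with z1 x1 y1
    apply integral_congr_ae
    filter_upwards [hX'] with z2 x2
    apply integral_congr_ae
    filter_upwards [hY'] with z3 y3
    apply integral_congr_ae
    filter_upwards [x1, x2] with z4 x14 x24
    apply integral_congr_ae
    filter_upwards [y1, y3] with z5 y15 y35
    rw [angle_integral _ _ _ x14 x24, angle_integral _ _ _ y15 y35]
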